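/- arXiv:0810.5269 — 4 statements merged into one kernel-verified Lean document; each statement's English description precedes it below -/
import Mathlib

section
/- Let μ be the infinite product over ℕ of the uniform probability measure on Fin 2 (assigning mass 1/2 to each point), a probability measure on ℕ → Fin 2, and let π : (ℕ → Fin 2) → AddCircle (1:ℝ) be defined by π(a) = the class of ∑_{n=0}^∞ (a n)/2^{n+1}. Then the pushforward measure π_*μ equals the Haar (Lebesgue) probability measure on AddCircle (1:ℝ). -/
open MeasureTheory
open scoped ENNReal

/-- Two probability measures on sequences in a finite type agree as soon as one of them is bounded
above by the other on cylinders over initial segments. -/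
theorem ext_of_prefix_cylinder_le {α : Type*} [Finite α] [MeasurableSpace α]
    [MeasurableSingletonClass α] {μ ν : Measure (ℕ → α)}
    [IsProbabilityMeasure μ] [IsProbabilityMeasure ν]
    (h : ∀ (n : ℕ) (b : Fin n → α),
      ν {a | ∀ i : Fin n, a i = b i} ≤ μ {a | ∀ i : Fin n, a i = b i}) :
    ν = μ := by
  have hmeas (n : ℕ) : Measurable fun (a : ℕ → α) (i : Fin n) ↦ a i := by fun_prop
  have hprefix (n : ℕ) :
      ν.map (fun a (i : Fin n) ↦ a i) = μ.map (fun a (i : Fin n) ↦ a i) := by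
    have := Measure.isProbabilityMeasure_map (μ := μ) (hmeas n).aemeasurable
    have := Measure.isProbabilityMeasure_map (μ := ν) (hmeas n).aemeasurable
    refine Measure.eq_of_le_of_isProbabilityMeasure (Measure.le_iff.2 fun s _ ↦ ?_)
    rw [← s.toFinite.coe_toFinset, ← sum_measure_singleton, ← sum_measure_singleton]
    refine Finset.sum_le_sum fun b _ ↦ ?_
    rw [Measure.map_apply (hmeas n) (measurableSet_singleton b),
      Measure.map_apply (hmeas n) (measurableSet_singleton b)]
    simpa [Set.preimage, funext_iff] using h n b
  refine IsProjectiveLimit.unique (P := fun I ↦ μ.map I.restrict) (fun I ↦ ?_) fun _ ↦ rfl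
  obtain ⟨n, hn⟩ := I.exists_nat_subset_range
  let g (c : Fin n → α) (i : I) : α := c ⟨i, Finset.mem_range.1 (hn i.2)⟩
  have hg : Measurable g := by fun_prop
  have hcomp : (I.restrict : (ℕ → α) → I → α) = g ∘ fun a i ↦ a i := rfl
  rw [hcomp, ← Measure.map_map hg (hmeas n), hprefix, Measure.map_map hg (hmeas n), ← hcomp]

theorem measurable_digits (b : ℕ) [NeZero b] : Measurable fun x : ℝ ↦ Real.digits x b := by
  refine measurable_pi_lambda _ fun i ↦ ?_
  exact (measurable_of_countable (Fin.ofNat b)).comp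
    (Nat.measurable_floor.comp (measurable_id.mul_const _))

/-- The set of reals in `[0, 1)` with prescribed first `n` digits in base `b` has length at most
`b⁻ⁿ`. -/
theorem volume_digits_cylinder_le (b : ℕ) [NeZero b] (n : ℕ) (d : Fin n → Fin b) :
    volume ({x : ℝ | ∀ i : Fin n, Real.digits x b i = d i} ∩ Set.Ico 0 1) ≤
      ((b : ℝ≥0∞)⁻¹) ^ n := by
  have hb : (0 : ℝ) < b := Nat.cast_pos.2 (NeZero.pos b)
  set s : ℝ := ∑ i : Fin n, (d i : ℝ) * ((b : ℝ) ^ ((i : ℕ) + 1))⁻¹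
  have hsub : {x : ℝ | ∀ i : Fin n, Real.digits x b i = d i} ∩ Set.Ico 0 1 ⊆
      Set.Icc s (s + (b⁻¹ : ℝ) ^ n) := by
    rintro x ⟨hx, hx01⟩
    have hs : ∑ i ∈ Finset.range n, Real.ofDigitsTerm (Real.digits x b) i = s := by
      rw [Finset.sum_range]
      exact Finset.sum_congr rfl fun i _ ↦ by rw [Real.ofDigitsTerm, hx i]
    have h₁ := Real.sum_ofDigitsTerm_digits_le (b := b) hx01 n
    have h₂ := Real.le_sum_ofDigitsTerm_digits (b := b) hx01 n
    rw [hs] at h₁ h₂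
    exact ⟨h₁, by linarith⟩
  refine (measure_mono hsub).trans ?_
  rw [Real.volume_Icc, add_sub_cancel_left, ENNReal.ofReal_pow (by positivity),
    ENNReal.ofReal_inv_of_pos hb, ENNReal.ofReal_natCast]

/-- Let `μ` be the fair-coin Bernoulli measure on `ℕ → Fin 2`, i.e. the
infinite product of uniform probability measures on `Fin 2`; it is characterized as the
probability measure giving each cylinder set on the first `n` coordinates mass `(1/2)^n`.
Then the pushforward of `μ` under the binary-expansion map `π` is the Haar (Lebesgue)
probability measure on the circle `ℝ/ℤ`. -/
theorem stmt_3
    (μ : Measure (ℕ → Fin 2)) [IsProbabilityMeasure μ]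
    (hμ : ∀ (n : ℕ) (b : Fin n → Fin 2),
      μ {a : ℕ → Fin 2 | ∀ i : Fin n, a (i : ℕ) = b i} = (1 / 2 : ℝ≥0∞) ^ n)
    (π : (ℕ → Fin 2) → AddCircle (1 : ℝ))
    (hπ : ∀ a : ℕ → Fin 2,
      π a = ((∑' n : ℕ, (a n : ℝ) / 2 ^ (n + 1) : ℝ) : AddCircle (1 : ℝ))) :
    Measure.map π μ = (volume : Measure (AddCircle (1 : ℝ))) := by
  have hπ' : π = fun a ↦ ((Real.ofDigits a : ℝ) : AddCircle (1 : ℝ)) := by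
    ext a
    simp [hπ, Real.ofDigits, Real.ofDigitsTerm, div_eq_mul_inv]
  have : IsProbabilityMeasure (volume.restrict (Set.Ico (0 : ℝ) 1)) := ⟨by simp⟩
  have hdigits := measurable_digits 2
  have := Measure.isProbabilityMeasure_map (μ := volume.restrict (Set.Ico (0 : ℝ) 1))
    hdigits.aemeasurable
  have hmap : (volume.restrict (Set.Ico (0 : ℝ) 1)).map (fun x ↦ Real.digits x 2) = μ := by
    refine ext_of_prefix_cylinder_le fun n b ↦ ?_
    have hcyl : MeasurableSet {a : ℕ → Fin 2 | ∀ i : Fin n, a i = b i} := by measurability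
    rw [hμ, Measure.map_apply hdigits hcyl, Measure.restrict_apply (hdigits hcyl)]
    simpa using volume_digits_cylinder_le 2 n b
  have hmk : Measurable ((↑) : ℝ → AddCircle (1 : ℝ)) := AddCircle.measurable_mk'
  have hmeas : Measurable π := by
    rw [hπ']
    exact hmk.comp Real.continuous_ofDigits.measurable
  calc μ.map π
      = (volume.restrict (Set.Ico (0 : ℝ) 1)).map (π ∘ fun x ↦ Real.digits x 2) := by
        rw [← hmap, Measure.map_map hmeas hdigits]
    _ = (volume.restrict (Set.Ico (0 : ℝ) 1)).map ((↑) : ℝ → AddCircle (1 : ℝ)) := by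
        refine Measure.map_congr ?_
        filter_upwards [ae_restrict_mem measurableSet_Ico] with x hx
        simp [hπ', Real.ofDigits_digits one_lt_two hx]
    _ = volume := by
        rw [Measure.restrict_congr_set Ico_ae_eq_Ioc]
        simpa using (UnitAddCircle.measurePreserving_mk 0).map_eq
end

section
/- Let A ∈ GL(2, ℤ) be hyperbolic with unstable slope κ_A, and suppose q is the minimal eventual period of the continued fraction expansion (a_n) of κ_A, i.e. q is the least positive integer for which there exists N with a_{n+q} = a_n for all n ≥ N. If q is odd, then there exists C ∈ GL(2, ℤ) with det C = −1 and C A C⁻¹ = A. -/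
/-- The orbit of `x` under the Gauss (continued fraction) map:
`x₀ = x`, `x_{n+1} = 1/(xₙ - ⌊xₙ⌋)`. -/
noncomputable def cfracAux (x : ℝ) : ℕ → ℝ
  | 0 => x
  | n + 1 => 1 / Int.fract (cfracAux x n)

/-- The continued fraction partial quotient sequence of `x`:
`a n = ⌊xₙ⌋` in the standard continued fraction algorithm. -/
noncomputable def cfrac (x : ℝ) (n : ℕ) : ℤ := ⌊cfracAux x n⌋

open scoped Matrix

/-- An integer matrix annihilating `(x, 1)` for an irrational `x` is zero. -/
theorem Matrix.eq_zero_of_mulVec_irrational {x : ℝ} (hx : Irrational x)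
    (D : Matrix (Fin 2) (Fin 2) ℤ)
    (hD : D.map (Int.cast : ℤ → ℝ) *ᵥ ![x, 1] = 0) : D = 0 := by
  have key (m n : ℤ) (h : (m : ℝ) * x + n = 0) : m = 0 ∧ n = 0 := by
    have hm : m = 0 := by
      by_contra hm
      exact ((hx.intCast_mul hm).add_intCast n).ne_zero h
    subst hm
    simpa using h
  have row (i : Fin 2) : D i 0 = 0 ∧ D i 1 = 0 := by
    have h := congrFun hD i
    simp only [Matrix.mulVec, dotProduct, Fin.sum_univ_two, Matrix.map_apply, Pi.zero_apply,
      Matrix.cons_val_zero, Matrix.cons_val_one, mul_one] at h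
    exact key _ _ h
  ext i j
  fin_cases j
  · exact (row i).1
  · exact (row i).2

/-- The slope of an eigenvector with eigenvalue off the unit circle is irrational. -/
theorem irrational_of_mulVec_eq_smul (A : Matrix.GeneralLinearGroup (Fin 2) ℤ) {x lam : ℝ}
    (hA : (A : Matrix (Fin 2) (Fin 2) ℤ).map (Int.cast : ℤ → ℝ) *ᵥ ![x, 1] = lam • ![x, 1])
    (hlam : 1 < |lam|) : Irrational x := by
  rintro ⟨r, rfl⟩
  have h0 := congrFun hA 0
  have h1 := congrFun hA 1
  simp only [Matrix.mulVec, dotProduct, Fin.sum_univ_two, Matrix.map_apply, Pi.smul_apply,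
    Matrix.cons_val_zero, Matrix.cons_val_one, mul_one, smul_eq_mul] at h0 h1
  have hdet := (Matrix.isUnit_iff_isUnit_det _).1 A.isUnit
  rw [Matrix.det_fin_two] at hdet
  generalize (A : Matrix (Fin 2) (Fin 2) ℤ) 0 0 = a at *
  generalize (A : Matrix (Fin 2) (Fin 2) ℤ) 0 1 = b at *
  generalize (A : Matrix (Fin 2) (Fin 2) ℤ) 1 0 = c at *
  generalize (A : Matrix (Fin 2) (Fin 2) ℤ) 1 1 = d at *
  obtain ⟨l, rfl⟩ : ∃ l : ℚ, (l : ℝ) = lam := ⟨c * r + d, by push_cast; exact h1⟩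
  have h0' : a * r + b = l * r := by exact_mod_cast h0
  have h1' : c * r + d = l := by exact_mod_cast h1
  have hchar : l * ((a + d) - l) = a * d - b * c := by
    linear_combination c * h0' + (l - a) * h1'
  have integral (m n : ℤ) (h : l * (m - l) = n) : IsIntegral ℤ l := by
    refine ⟨Polynomial.X ^ 2 - Polynomial.C m * Polynomial.X + Polynomial.C n,
      by monicity!, ?_⟩
    simp only [Polynomial.eval₂_add, Polynomial.eval₂_sub, Polynomial.eval₂_mul,
      Polynomial.eval₂_pow, Polynomial.eval₂_X, Polynomial.eval₂_C]
    rw [eq_intCast, eq_intCast]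
    linear_combination -h
  obtain ⟨y, rfl⟩ := IsIntegrallyClosed.isIntegral_iff.1
    (integral (a + d) (a * d - b * c) (by exact_mod_cast hchar))
  have hy : y * ((a + d) - y) = a * d - b * c := by
    rw [algebraMap_int_eq, eq_intCast] at hchar
    exact_mod_cast hchar
  have hu : IsUnit y := isUnit_of_mul_isUnit_left (hy ▸ hdet)
  rcases Int.isUnit_iff.1 hu with rfl | rfl <;> simp at hlam

theorem irrational_cfracAux {x : ℝ} (hx : Irrational x) (n : ℕ) : Irrational (cfracAux x n) := by
  induction n with
  | zero => exact hx
  | succ n ih =>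
    rw [cfracAux, one_div, irrational_inv_iff]
    exact ih.sub_intCast _

theorem cfracAux_add (x : ℝ) (m n : ℕ) : cfracAux x (m + n) = cfracAux (cfracAux x m) n := by
  induction n with
  | zero => rfl
  | succ n ih => rw [← add_assoc, cfracAux, ih, cfracAux]

theorem cfracAux_eq (x : ℝ) (n : ℕ) :
    cfracAux x n = cfrac x n + 1 / cfracAux x (n + 1) := by
  rw [cfracAux, one_div_one_div, cfrac, Int.floor_add_fract]

theorem one_lt_cfracAux_succ {x : ℝ} (hx : Irrational x) (n : ℕ) :
    1 < cfracAux x (n + 1) := by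
  have h : Int.fract (cfracAux x n) ≠ 0 := ((irrational_cfracAux hx n).sub_intCast _).ne_zero
  exact one_lt_one_div ((Int.fract_nonneg _).lt_of_ne' h) (Int.fract_lt_one _)

/-- Two successive continued fraction steps contract distances by a factor of at least four. -/
theorem abs_cfracAux_sub_le {x y : ℝ} (hx : Irrational x) (hy : Irrational y)
    (h : ∀ n, cfrac x n = cfrac y n) (n : ℕ) :
    4 * |cfracAux x n - cfracAux y n| ≤ |cfracAux x (n + 2) - cfracAux y (n + 2)| := by
  have step (m : ℕ) : |cfracAux x (m + 1) - cfracAux y (m + 1)| =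
      (cfracAux x (m + 1) * cfracAux y (m + 1)) * |cfracAux x m - cfracAux y m| := by
    have hx1 := one_lt_cfracAux_succ hx m
    have hy1 := one_lt_cfracAux_succ hy m
    rw [cfracAux_eq x m, cfracAux_eq y m, h m, abs_sub_comm,
      ← abs_of_pos (by positivity : 0 < cfracAux x (m + 1) * cfracAux y (m + 1)), ← abs_mul]
    congr 1
    field_simp
    ring
  have two {z : ℝ} (hz : Irrational z) : 2 ≤ cfracAux z (n + 1) * cfracAux z (n + 2) := by
    have h1 := one_lt_cfracAux_succ hz n
    have h2 := one_lt_cfracAux_succ hz (n + 1)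
    have hf : (1 : ℝ) ≤ cfrac z (n + 1) := by
      exact_mod_cast Int.le_floor.2 (by exact_mod_cast h1.le)
    rw [cfracAux_eq z (n + 1), add_mul, one_div, inv_mul_cancel₀ (by positivity)]
    nlinarith
  rw [step (n + 1), step n, ← mul_assoc]
  gcongr
  nlinarith [mul_le_mul (two hx) (two hy) (by norm_num) (by linarith [two hx])]

theorem eq_of_cfrac_eq {x y : ℝ} (hx : Irrational x) (hy : Irrational y)
    (h : ∀ n, cfrac x n = cfrac y n) : x = y := by
  have bound (k : ℕ) : 4 ^ k * |x - y| ≤ |cfracAux x (2 * k) - cfracAux y (2 * k)| := by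
    induction k with
    | zero => simp [cfracAux]
    | succ k ih =>
      have := abs_cfracAux_sub_le hx hy h (2 * k)
      rw [pow_succ]
      exact le_trans (by linarith) this
  by_contra hne
  have hpos : 0 < |x - y| := abs_pos.2 (sub_ne_zero.2 hne)
  obtain ⟨k, hk⟩ := pow_unbounded_of_one_lt (1 / |x - y|) (by norm_num : (1 : ℝ) < 4)
  rw [div_lt_iff₀ hpos] at hk
  linarith [bound k, Int.abs_sub_lt_one_of_floor_eq_floor (h (2 * k))]

/-- The product of the first `n` continued fraction matrices sends the direction of the `n`-th
complete quotient of `x` to that of `x`. -/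
theorem exists_mulVec_cfracAux {x : ℝ} (hx : Irrational x) (n : ℕ) :
    ∃ (P : Matrix.GeneralLinearGroup (Fin 2) ℤ) (s : ℝ), s ≠ 0 ∧
      (P : Matrix (Fin 2) (Fin 2) ℤ).det = (-1) ^ n ∧
      (P : Matrix (Fin 2) (Fin 2) ℤ).map (Int.cast : ℤ → ℝ) *ᵥ ![cfracAux x n, 1]
        = s • ![x, 1] := by
  induction n with
  | zero => exact ⟨1, 1, by simp [cfracAux]⟩
  | succ n ih =>
    obtain ⟨P, s, hs, hdet, hP⟩ := ih
    have hpos := one_lt_cfracAux_succ hx n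
    let M : Matrix.GeneralLinearGroup (Fin 2) ℤ :=
      ⟨!![cfrac x n, 1; 1, 0], !![0, 1; 1, -cfrac x n],
        by simp [Matrix.one_fin_two], by simp [Matrix.one_fin_two]⟩
    have hM : (M : Matrix (Fin 2) (Fin 2) ℤ).map (Int.cast : ℤ → ℝ) *ᵥ ![cfracAux x (n + 1), 1]
        = cfracAux x (n + 1) • ![cfracAux x n, 1] := by
      rw [cfracAux_eq x n]
      ext i
      fin_cases i
      · simp [M, Matrix.mulVec, dotProduct, Fin.sum_univ_two]
        field_simp
      · simp [M, Matrix.mulVec, dotProduct, Fin.sum_univ_two]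
    refine ⟨P * M, cfracAux x (n + 1) * s, mul_ne_zero (by positivity) hs, ?_, ?_⟩
    · rw [Units.val_mul, Matrix.det_mul, hdet, pow_succ]
      simp [M, Matrix.det_fin_two]
    · rw [Units.val_mul, Matrix.map_mul_intCast, ← Matrix.mulVec_mulVec, hM,
        Matrix.mulVec_smul, hP, smul_smul]

/-- If `A ∈ GL(2, ℤ)` is hyperbolic with unstable slope `κ` and the
minimal eventual period `q` of the continued fraction expansion of `κ` is odd, then
there exists `C ∈ GL(2, ℤ)` with `det C = −1` and `C A C⁻¹ = A`. -/
theorem stmt_10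
    (A : Matrix.GeneralLinearGroup (Fin 2) ℤ)
    (κ lam : ℝ)
    (hA : Matrix.mulVec ((A : Matrix (Fin 2) (Fin 2) ℤ).map (Int.cast : ℤ → ℝ)) ![κ, 1]
        = lam • ![κ, 1])
    (hlam : 1 < |lam|)
    (q : ℕ)
    (hq : IsLeast {q' : ℕ | 0 < q' ∧ ∃ N : ℕ, ∀ n ≥ N, cfrac κ (n + q') = cfrac κ n} q)
    (hodd : Odd q) :
    ∃ C : Matrix.GeneralLinearGroup (Fin 2) ℤ,
      Matrix.det (C : Matrix (Fin 2) (Fin 2) ℤ) = -1 ∧ C * A * C⁻¹ = A := by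
  have hκ := irrational_of_mulVec_eq_smul A hA hlam
  obtain ⟨-, N, hN⟩ := hq.1
  set y := cfracAux κ N with hy
  have hyirr : Irrational y := irrational_cfracAux hκ N
  have hper : cfracAux y q = y := by
    refine eq_of_cfrac_eq (irrational_cfracAux hyirr q) hyirr fun n => ?_
    have h := hN (N + n) (by omega)
    rw [show N + n + q = N + (q + n) by ring] at h
    simpa only [cfrac, cfracAux_add] using h
  obtain ⟨P, s, hs, -, hP⟩ := exists_mulVec_cfracAux hκ N
  obtain ⟨Q, t, -, hQdet, hQ⟩ := exists_mulVec_cfracAux hyirr q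
  rw [hper] at hQ
  rw [← hy] at hP
  have hPinv : ((P⁻¹ : Matrix.GeneralLinearGroup (Fin 2) ℤ) : Matrix (Fin 2) (Fin 2) ℤ).map
      (Int.cast : ℤ → ℝ) *ᵥ ![κ, 1] = s⁻¹ • ![y, 1] := by
    rw [eq_inv_smul_iff₀ hs, ← Matrix.mulVec_smul, ← hP, Matrix.mulVec_mulVec,
      ← Matrix.map_mul_intCast, ← Units.val_mul, inv_mul_cancel]
    simp
  have hC : ((P * Q * P⁻¹ : Matrix.GeneralLinearGroup (Fin 2) ℤ) :
      Matrix (Fin 2) (Fin 2) ℤ).map (Int.cast : ℤ → ℝ) *ᵥ ![κ, 1] = t • ![κ, 1] := by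
    rw [Units.val_mul, Units.val_mul, Matrix.map_mul_intCast, Matrix.map_mul_intCast,
      ← Matrix.mulVec_mulVec, ← Matrix.mulVec_mulVec, hPinv, Matrix.mulVec_smul, hQ,
      Matrix.mulVec_smul, Matrix.mulVec_smul, hP, smul_smul, smul_smul,
      show s⁻¹ * t * s = t by field_simp]
  refine ⟨P * Q * P⁻¹, ?_, ?_⟩
  · have h : (P : Matrix (Fin 2) (Fin 2) ℤ).det *
        ((P⁻¹ : Matrix.GeneralLinearGroup (Fin 2) ℤ) : Matrix (Fin 2) (Fin 2) ℤ).det = 1 := by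
      rw [← Matrix.det_mul, ← Units.val_mul, mul_inv_cancel, Units.val_one, Matrix.det_one]
    rw [Units.val_mul, Units.val_mul, Matrix.det_mul, Matrix.det_mul, mul_right_comm, h, hQdet,
      hodd.neg_one_pow, one_mul]
  · rw [mul_inv_eq_iff_eq_mul]
    refine Units.ext (sub_eq_zero.1 (Matrix.eq_zero_of_mulVec_irrational hκ _ ?_))
    rw [Matrix.map_sub _ (fun a b => Int.cast_sub a b), Matrix.sub_mulVec, Units.val_mul _ A,
      Units.val_mul A, Matrix.map_mul_intCast, Matrix.map_mul_intCast, ← Matrix.mulVec_mulVec,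
      ← Matrix.mulVec_mulVec, hA, hC, Matrix.mulVec_smul, Matrix.mulVec_smul, hA, hC,
      smul_comm, sub_self]
end

section
/- Let A ∈ GL(2, ℤ) be hyperbolic. Then there exists B ∈ GL(2, ℤ) such that the centralizer of A in GL(2, ℤ) equals {± B^n : n ∈ ℤ}; that is, {C ∈ GL(2, ℤ) : C A = A C} = {B^n : n ∈ ℤ} ∪ {−B^n : n ∈ ℤ}. -/
/-- A real root of `X² - tX + d` with integer coefficients, of absolute value in `(0, 1)`,
is irrational. -/
theorem int_mul_ne_of_quadratic_root {x : ℝ} {t d : ℤ} (hx : x ^ 2 - t * x + d = 0)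
    (hx0 : x ≠ 0) (hx1 : |x| < 1) {q : ℤ} (hq : q ≠ 0) (k : ℤ) : (q : ℝ) * x ≠ k := by
  intro h
  have hqr : (q : ℝ) ≠ 0 := by exact_mod_cast hq
  have hxq : x = (((k : ℚ) / q : ℚ) : ℝ) := by
    push_cast
    field_simp
    linarith
  have hroot : ((k : ℚ) / q) ^ 2 - t * ((k : ℚ) / q) + d = 0 := by
    rw [hxq] at hx
    exact_mod_cast hx
  have hint : IsIntegral ℤ ((k : ℚ) / q) := by
    refine ⟨Polynomial.X ^ 2 - Polynomial.C t * Polynomial.X + Polynomial.C d, by monicity!, ?_⟩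
    simp only [Polynomial.eval₂_add, Polynomial.eval₂_sub, Polynomial.eval₂_mul,
      Polynomial.eval₂_pow, Polynomial.eval₂_X, Polynomial.eval₂_C]
    simpa using hroot
  obtain ⟨y, hy⟩ := IsIntegrallyClosed.isIntegral_iff.mp hint
  have hxy : x = (y : ℝ) := by
    rw [hxq, ← hy]
    simp
  rw [hxy] at hx0 hx1
  have h1 : |y| < 1 := by exact_mod_cast hx1
  exact hx0 (by exact_mod_cast Int.abs_lt_one_iff.mp h1)

/-- A real number of absolute value greater than `1` that is an eigenvalue of a matrix in
`GL(2, ℤ)` has absolute value at least `3 / 2`. -/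
theorem three_halves_le_of_quadratic_unit {x : ℝ} {t d : ℤ} (hd : d = 1 ∨ d = -1)
    (hx : x ^ 2 - t * x + d = 0) (hx1 : 1 < |x|) : 3 / 2 ≤ |x| := by
  wlog hpos : 0 ≤ x generalizing x t
  · have := this (x := -x) (t := -t) (by push_cast; linarith) (by simpa using hx1) (by linarith)
    simpa using this
  rw [abs_of_nonneg hpos] at *
  by_contra! hlt
  rcases hd with rfl | rfl
  · push_cast at hx
    have h1 : (2 : ℝ) < t := by nlinarith
    have h2 : (3 : ℝ) ≤ t := by exact_mod_cast (by exact_mod_cast h1 : (2 : ℤ) < t)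
    nlinarith
  · push_cast at hx
    have h1 : (0 : ℝ) < t := by nlinarith
    have h2 : (1 : ℝ) ≤ t := by exact_mod_cast (by exact_mod_cast h1 : (0 : ℤ) < t)
    nlinarith

/-- A subgroup of `GL(2, ℤ)` with a common real eigenvector `(1, θ)` of irrational slope is
generated by one element up to sign. -/
theorem exists_generator_up_to_sign (H : Subgroup (Matrix.GeneralLinearGroup (Fin 2) ℤ)) (θ : ℝ)
    (hθ : ∀ p q : ℤ, (p : ℝ) + q * θ = 0 → p = 0 ∧ q = 0)
    (hH : ∀ C ∈ H, (C 1 0 : ℝ) + C 1 1 * θ = (C 0 0 + C 0 1 * θ) * θ) :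
    ∃ B ∈ H, ∀ C ∈ H, ∃ n : ℤ, C = B ^ n ∨ C = -(B ^ n) := by
  let χ : H →* ℝ :=
    { toFun := fun C => (C.1 0 0 : ℝ) + C.1 0 1 * θ
      map_one' := by simp
      map_mul' := by
        rintro ⟨C, hC⟩ ⟨C', hC'⟩
        have := hH C' hC'
        simp only [Units.val_mul, Matrix.mul_apply, Fin.sum_univ_two, MulMemClass.mk_mul_mk]
        push_cast
        linear_combination (C 0 1 : ℝ) * this }
  have hχ : ∀ C : H, χ C = (C.1 0 0 : ℝ) + C.1 0 1 * θ := fun _ => rfl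
  have hχ0 : ∀ C, χ C ≠ 0 := fun C => ((Group.isUnit C).map χ).ne_zero
  let L : Additive H →+ ℝ := AddMonoidHom.mk' (fun C => Real.log |χ C.toMul|) (by
    intro C C'
    rw [toMul_add, map_mul, abs_mul, Real.log_mul (by simpa using hχ0 _) (by simpa using hχ0 _)])
  have hL : ∀ C : H, L (Additive.ofMul C) = Real.log |χ C| := fun _ => rfl
  have hgap : Disjoint (L.range : Set ℝ) (Set.Ioo 0 (Real.log (3 / 2))) := by
    rw [Set.disjoint_left]
    rintro _ ⟨C, rfl⟩ ⟨h0, h1⟩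
    obtain ⟨C, rfl⟩ := Additive.ofMul.surjective C
    rw [hL] at h0 h1
    have hpos : 0 < |χ C| := abs_pos.mpr (hχ0 C)
    have hgt : 1 < |χ C| := (Real.log_pos_iff hpos.le).mp h0
    have hlt : |χ C| < 3 / 2 := (Real.log_lt_log_iff hpos (by norm_num)).mp h1
    refine hlt.not_ge (three_halves_le_of_quadratic_unit (t := C.1 0 0 + C.1 1 1)
      (d := (C.1 : Matrix (Fin 2) (Fin 2) ℤ).det) (Int.isUnit_iff.mp ?_) ?_ hgt)
    · exact (Matrix.isUnit_iff_isUnit_det _).mp C.1.isUnit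
    · rw [Matrix.det_fin_two, hχ]
      push_cast
      linear_combination -(C.1 0 1 : ℝ) * hH C.1 C.2
  obtain ⟨β, hβ⟩ := AddSubgroup.cyclic_of_isolated_zero (Real.log_pos (by norm_num)) hgap
  obtain ⟨B, hB⟩ : β ∈ L.range := hβ ▸ AddSubgroup.subset_closure rfl
  obtain ⟨B, rfl⟩ := Additive.ofMul.surjective B
  have hker : ∀ C : H, L (Additive.ofMul C) = 0 → (C : Matrix.GeneralLinearGroup (Fin 2) ℤ) = 1 ∨
      (C : Matrix.GeneralLinearGroup (Fin 2) ℤ) = -1 := by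
    intro C hC
    have hχC : |χ C| = 1 := by
      rw [hL] at hC
      exact Real.eq_one_of_pos_of_log_eq_zero (abs_pos.mpr (hχ0 C)) hC
    have hrow := hH C.1 C.2
    rw [← hχ] at hrow
    rcases (abs_eq zero_le_one).mp hχC with h | h
    · left
      rw [h] at hrow
      rw [hχ] at h
      have h1 := hθ (C.1 0 0 - 1) (C.1 0 1) (by push_cast; linarith)
      have h2 := hθ (C.1 1 0) (C.1 1 1 - 1) (by push_cast; linarith)
      ext i j
      fin_cases i <;> fin_cases j <;> simp <;> omega
    · right
      rw [h] at hrow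
      rw [hχ] at h
      have h1 := hθ (C.1 0 0 + 1) (C.1 0 1) (by push_cast; linarith)
      have h2 := hθ (C.1 1 0) (C.1 1 1 + 1) (by push_cast; linarith)
      ext i j
      fin_cases i <;> fin_cases j <;> simp <;> omega
  refine ⟨B, B.2, fun C hC => ?_⟩
  have hmem : L (Additive.ofMul ⟨C, hC⟩) ∈ AddSubgroup.closure {β} := hβ ▸ ⟨_, rfl⟩
  obtain ⟨n, hn⟩ := AddSubgroup.mem_closure_singleton.mp hmem
  refine ⟨n, ?_⟩
  have h0 : L (Additive.ofMul (⟨C, hC⟩ * (B ^ n)⁻¹)) = 0 := by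
    rw [ofMul_mul, ofMul_inv, ofMul_zpow, map_add, map_neg, map_zsmul, hB, hn, add_neg_cancel]
  refine (hker _ h0).imp (fun h => ?_) (fun h => ?_)
  · simpa [mul_inv_eq_one] using h
  · have h' : C * ((B : Matrix.GeneralLinearGroup (Fin 2) ℤ) ^ n)⁻¹ = -1 := by simpa using h
    rw [mul_inv_eq_iff_eq_mul] at h'
    simpa using h'


/-- For a hyperbolic `A ∈ GL(2, ℤ)` (real eigenvalues `λ, μ` with
`|λ| > 1`, `|μ| < 1`), the centralizer of `A` in `GL(2, ℤ)` is `{± Bⁿ : n ∈ ℤ}` for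
some `B ∈ GL(2, ℤ)`. -/
theorem stmt_14
    (A : Matrix.GeneralLinearGroup (Fin 2) ℤ)
    (lam mu : ℝ)
    (htr : lam + mu = Matrix.trace ((A : Matrix (Fin 2) (Fin 2) ℤ).map (Int.cast : ℤ → ℝ)))
    (hdet : lam * mu = Matrix.det ((A : Matrix (Fin 2) (Fin 2) ℤ).map (Int.cast : ℤ → ℝ)))
    (hlam : 1 < |lam|) (hmu : |mu| < 1) :
    ∃ B : Matrix.GeneralLinearGroup (Fin 2) ℤ,
      {C : Matrix.GeneralLinearGroup (Fin 2) ℤ | C * A = A * C}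
        = {C : Matrix.GeneralLinearGroup (Fin 2) ℤ | ∃ n : ℤ, C = B ^ n ∨ C = -(B ^ n)} := by
  set a := A 0 0 with ha
  set b := A 0 1 with hb
  set c := A 1 0 with hc
  set d := A 1 1 with hd
  have htr' : lam + mu = a + d := by simpa [Matrix.trace_fin_two] using htr
  have hdet' : lam * mu = a * d - b * c := by simpa [Matrix.det_fin_two] using hdet
  have hunit : IsUnit (A : Matrix (Fin 2) (Fin 2) ℤ).det :=
    (Matrix.isUnit_iff_isUnit_det _).mp A.isUnit
  have hmu0 : mu ≠ 0 := by
    rintro rfl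
    apply hunit.ne_zero
    rw [Matrix.det_fin_two]
    have : (a * d - b * c : ℝ) = 0 := by linarith
    exact_mod_cast this
  have hroot : mu ^ 2 - ((a + d : ℤ) : ℝ) * mu + ((a * d - b * c : ℤ) : ℝ) = 0 := by
    push_cast
    rw [← htr', ← hdet']
    ring
  have hirr := fun {q : ℤ} (hq : q ≠ 0) (k : ℤ) =>
    int_mul_ne_of_quadratic_root hroot hmu0 hmu hq k
  push_cast at hroot
  have hb0 : (b : ℝ) ≠ 0 := by
    intro hb0
    have h : (mu - a) * (mu - d) = 0 := by
      rw [hb0] at hroot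
      linear_combination hroot
    rcases mul_eq_zero.mp h with h | h
    · exact hirr one_ne_zero a (by push_cast; linarith)
    · exact hirr one_ne_zero d (by push_cast; linarith)
  obtain ⟨B, hB, hgen⟩ := exists_generator_up_to_sign (Subgroup.centralizer {A}) ((mu - a) / b)
    (by
      intro p q h
      have hq : q = 0 := by
        by_contra hq
        refine hirr hq (q * a - p * b) ?_
        field_simp at h
        push_cast
        linarith
      subst hq
      exact ⟨by simpa using h, rfl⟩)
    (by
      intro C hC
      have hcomm := congrArg Units.val (Subgroup.mem_centralizer_singleton_iff.mp hC)
      have h00 := congrFun (congrFun hcomm 0) 0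
      have h01 := congrFun (congrFun hcomm 0) 1
      simp only [Units.val_mul, Matrix.mul_apply, Fin.sum_univ_two, ← ha, ← hb, ← hc, ← hd]
        at h00 h01
      have h00' : (C 0 0 * a + C 0 1 * c : ℝ) = a * C 0 0 + b * C 1 0 := by exact_mod_cast h00
      have h01' : (C 0 0 * b + C 0 1 * d : ℝ) = a * C 0 1 + b * C 1 1 := by exact_mod_cast h01
      field_simp
      linear_combination (-(b : ℝ)) * h00' - (mu - a) * h01' - (C 0 1 : ℝ) * hroot)
  refine ⟨B, Set.ext fun C => ⟨fun hC => hgen C ?_, ?_⟩⟩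
  · exact Subgroup.mem_centralizer_singleton_iff.mpr hC
  · have hcomm (n : ℤ) : B ^ n * A = A * B ^ n :=
      Subgroup.mem_centralizer_singleton_iff.mp (zpow_mem hB n)
    rintro ⟨n, rfl | rfl⟩
    · exact hcomm n
    · change -(B ^ n) * A = A * -(B ^ n)
      rw [neg_mul, mul_neg, hcomm n]
end

section
/- Let ω > 1 be irrational with continued fraction expansion ω = [b_0; b_1, b_2, …], and let p_k, q_k be the convergent numerators and denominators defined by p_{−2} = 0, p_{−1} = 1, q_{−2} = 1, q_{−1} = 0 and p_k = b_k p_{k−1} + p_{k−2}, q_k = b_k q_{k−1} + q_{k−2} for k ≥ 0. Let p ∈ ℤ and q ≥ 1 be integers with |qω − p| < 1. Then the following are equivalent: (i) there is no pair of integers (p', q') with 0 < q' < q such that q'ω − p' lies in the closed interval with endpoints 0 and qω − p; (ii) there exist an integer k ≥ −1 and an integer l with 1 ≤ l ≤ b_{k+1} such that p = l p_k + p_{k−1} and q = l q_k + q_{k−1}. -/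
theorem one_lt_cfracAux_and_irrational {ω : ℝ} (hω : 1 < ω) (hirr : Irrational ω) (k : ℕ) :
    1 < cfracAux ω k ∧ Irrational (cfracAux ω k) := by
  induction k with
  | zero => exact ⟨hω, hirr⟩
  | succ k ih =>
    have hfr : Irrational (Int.fract (cfracAux ω k)) := ih.2.sub_intCast _
    have hpos : 0 < Int.fract (cfracAux ω k) :=
      lt_of_le_of_ne (Int.fract_nonneg _) (Ne.symm hfr.ne_zero)
    refine ⟨?_, ?_⟩
    · rw [cfracAux]
      exact one_lt_one_div hpos (Int.fract_lt_one _)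
    · rw [cfracAux, one_div]
      exact hfr.inv

theorem one_le_cfrac {ω : ℝ} (hω : 1 < ω) (hirr : Irrational ω) (k : ℕ) : 1 ≤ cfrac ω k := by
  rw [cfrac, Int.le_floor]
  exact_mod_cast (one_lt_cfracAux_and_irrational hω hirr k).1.le

theorem Set.mem_uIcc_zero_iff_of_sign {s x d : ℝ} (hs : s = 1 ∨ s = -1) (hd : 0 < s * d) :
    x ∈ Set.uIcc 0 d ↔ 0 ≤ s * x ∧ s * x ≤ s * d := by
  rcases hs with rfl | rfl
  · rw [Set.uIcc_of_le (by linarith), Set.mem_Icc, one_mul, one_mul]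
  · rw [Set.uIcc_of_ge (by linarith), Set.mem_Icc]
    constructor <;> rintro ⟨h₁, h₂⟩ <;> constructor <;> linarith

section Convergents

variable {ω : ℝ} {P Q : ℕ → ℤ}

/-- The signed errors `(-1)^k (Q k * ω - P k)` are positive, and consecutive ones have the
complete quotient as their ratio. -/
theorem convergent_error (hω : 1 < ω) (hirr : Irrational ω)
    (hP0 : P 0 = 0) (hP1 : P 1 = 1) (hQ0 : Q 0 = 1) (hQ1 : Q 1 = 0)
    (hPrec : ∀ k : ℕ, P (k + 2) = cfrac ω k * P (k + 1) + P k)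
    (hQrec : ∀ k : ℕ, Q (k + 2) = cfrac ω k * Q (k + 1) + Q k) (k : ℕ) :
    0 < (-1 : ℝ) ^ k * (Q k * ω - P k) ∧ (-1 : ℝ) ^ k * (Q (k + 1) * ω - P (k + 1)) < 0 ∧
      Q k * ω - P k = -cfracAux ω k * (Q (k + 1) * ω - P (k + 1)) := by
  induction k with
  | zero => simp [hP0, hP1, hQ0, hQ1, cfracAux]; linarith
  | succ k ih =>
    obtain ⟨-, h₁, h₂⟩ := ih
    have hfr : 0 < Int.fract (cfracAux ω k) :=
      lt_of_le_of_ne (Int.fract_nonneg _)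
        (Ne.symm ((one_lt_cfracAux_and_irrational hω hirr k).2.sub_intCast _).ne_zero)
    have key : (Q (k + 2) * ω - P (k + 2) : ℝ) =
        -Int.fract (cfracAux ω k) * (Q (k + 1) * ω - P (k + 1)) := by
      rw [hPrec, hQrec, Int.fract]
      push_cast
      rw [cfrac]
      linear_combination h₂
    refine ⟨by rw [pow_succ]; linarith, ?_, ?_⟩
    · rw [key, pow_succ]
      nlinarith
    · rw [key, cfracAux]
      field_simp

theorem convergent_det
    (hP0 : P 0 = 0) (hP1 : P 1 = 1) (hQ0 : Q 0 = 1) (hQ1 : Q 1 = 0)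
    (hPrec : ∀ k : ℕ, P (k + 2) = cfrac ω k * P (k + 1) + P k)
    (hQrec : ∀ k : ℕ, Q (k + 2) = cfrac ω k * Q (k + 1) + Q k) (k : ℕ) :
    P (k + 1) * Q k - P k * Q (k + 1) = (-1) ^ k := by
  induction k with
  | zero => simp [hP0, hP1, hQ0, hQ1]
  | succ k ih =>
    rw [hPrec, hQrec, pow_succ]
    linear_combination -ih

theorem one_le_convergent_den (hω : 1 < ω) (hirr : Irrational ω) (hQ0 : Q 0 = 1) (hQ1 : Q 1 = 0)
    (hQrec : ∀ k : ℕ, Q (k + 2) = cfrac ω k * Q (k + 1) + Q k) (k : ℕ) :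
    1 ≤ Q (k + 2) := by
  have h : ∀ k, 0 ≤ Q (k + 1) ∧ 1 ≤ Q (k + 2) := by
    intro k
    induction k with
    | zero => simp [hQrec, hQ0, hQ1]
    | succ k ih =>
      refine ⟨by linarith [ih.2], ?_⟩
      rw [hQrec (k + 1)]
      nlinarith [ih.1, ih.2, one_le_cfrac hω hirr (k + 1)]
  exact (h k).2

theorem convergent_den_nonneg (hω : 1 < ω) (hirr : Irrational ω) (hQ0 : Q 0 = 1) (hQ1 : Q 1 = 0)
    (hQrec : ∀ k : ℕ, Q (k + 2) = cfrac ω k * Q (k + 1) + Q k) : ∀ k : ℕ, 0 ≤ Q k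
  | 0 => by simp [hQ0]
  | 1 => hQ1.ge
  | k + 2 => zero_le_one.trans (one_le_convergent_den hω hirr hQ0 hQ1 hQrec k)

/-- Every lattice point in the cone spanned by two consecutive convergents lies in one of the
subcones spanned by `(P k, Q k)` and `(P (k + 2), Q (k + 2))`. -/
theorem exists_convergent_cone (hω : 1 < ω) (hirr : Irrational ω)
    (hPrec : ∀ k : ℕ, P (k + 2) = cfrac ω k * P (k + 1) + P k)
    (hQrec : ∀ k : ℕ, Q (k + 2) = cfrac ω k * Q (k + 1) + Q k) {p q : ℤ} (n : ℕ) :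
    ∀ (k : ℕ) (c a : ℤ), 1 ≤ c → 0 ≤ a → a + c ≤ n →
      p = c * P k + a * P (k + 1) → q = c * Q k + a * Q (k + 1) →
      ∃ (k : ℕ) (c a : ℤ), 1 ≤ c ∧ 0 ≤ a ∧ a < c * cfrac ω k ∧
        p = c * P k + a * P (k + 1) ∧ q = c * Q k + a * Q (k + 1) := by
  induction n with
  | zero => intro k c a hc ha hn; push_cast at hn; omega
  | succ n ih =>
    intro k c a hc ha hn hp hq
    have hb := one_le_cfrac hω hirr k
    rcases lt_trichotomy a (c * cfrac ω k) with h | h | h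
    · exact ⟨k, c, a, hc, ha, h, hp, hq⟩
    · have hb' := one_le_cfrac hω hirr (k + 2)
      refine ⟨k + 2, c, 0, hc, le_rfl, by positivity, ?_, ?_⟩
      · rw [hp, h, hPrec]; ring
      · rw [hq, h, hQrec]; ring
    · refine ih (k + 1) (a - c * cfrac ω k) c (by linarith) (by linarith) ?_ ?_ ?_
      · push_cast at hn
        nlinarith
      · rw [hp, hPrec]; ring
      · rw [hq, hQrec]; ring

theorem semiconvergent_best (hω : 1 < ω) (hirr : Irrational ω)
    (hP0 : P 0 = 0) (hP1 : P 1 = 1) (hQ0 : Q 0 = 1) (hQ1 : Q 1 = 0)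
    (hPrec : ∀ k : ℕ, P (k + 2) = cfrac ω k * P (k + 1) + P k)
    (hQrec : ∀ k : ℕ, Q (k + 2) = cfrac ω k * Q (k + 1) + Q k) {p q l : ℤ} (hq : 1 ≤ q)
    {k : ℕ} (hl : l ≤ cfrac ω k)
    (hp : p = l * P (k + 1) + P k) (hql : q = l * Q (k + 1) + Q k) :
    ¬ ∃ p' q' : ℤ, 0 < q' ∧ q' < q ∧
      ((q' : ℝ) * ω - (p' : ℝ)) ∈ Set.uIcc (0 : ℝ) ((q : ℝ) * ω - (p : ℝ)) := by
  rintro ⟨p', q', hq0, hqq, hmem⟩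
  obtain ⟨-, hneg, -⟩ := convergent_error hω hirr hP0 hP1 hQ0 hQ1 hPrec hQrec k
  have hnext := (convergent_error hω hirr hP0 hP1 hQ0 hQ1 hPrec hQrec (k + 2)).1
  have hdet := convergent_det hP0 hP1 hQ0 hQ1 hPrec hQrec k
  have hQ := convergent_den_nonneg hω hirr hQ0 hQ1 hQrec (k + 1)
  have hs : ((-1 : ℤ) ^ k) * (-1) ^ k = 1 := by rw [← mul_pow]; simp
  have hsR : (-1 : ℝ) ^ k = 1 ∨ (-1 : ℝ) ^ k = -1 := neg_one_pow_eq_or ℝ k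
  have hD : 0 < (-1 : ℝ) ^ k * (q * ω - p) := by
    have hlR : (l : ℝ) ≤ cfrac ω k := by exact_mod_cast hl
    rw [hPrec, hQrec, pow_add] at hnext
    rw [hp, hql]
    push_cast at hnext ⊢
    nlinarith
  rw [Set.mem_uIcc_zero_iff_of_sign hsR hD] at hmem
  obtain ⟨a, c, hp', hq'⟩ : ∃ a c : ℤ, p' = a * P (k + 1) + c * p ∧ q' = a * Q (k + 1) + c * q := by
    have hdet' : P (k + 1) * q - p * Q (k + 1) = (-1) ^ k := by
      rw [hp, hql]; linear_combination hdet
    refine ⟨(-1) ^ k * (p' * q - p * q'), (-1) ^ k * (P (k + 1) * q' - p' * Q (k + 1)), ?_, ?_⟩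
    · linear_combination -p' * hs - p' * (-1) ^ k * hdet'
    · linear_combination -q' * hs - q' * (-1) ^ k * hdet'
  have hD' : (-1 : ℝ) ^ k * (q' * ω - p') =
      a * ((-1 : ℝ) ^ k * (Q (k + 1) * ω - P (k + 1))) + c * ((-1 : ℝ) ^ k * (q * ω - p)) := by
    rw [hp', hq']; push_cast; ring
  rw [hD'] at hmem
  rcases le_or_gt c 0 with hc | hc
  · have ha : 0 < a := by
      by_contra! ha
      nlinarith [mul_nonneg (neg_nonneg.2 ha) hQ]
    have haR : (0 : ℝ) < a := by exact_mod_cast ha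
    have hcR : (c : ℝ) ≤ 0 := by exact_mod_cast hc
    nlinarith [hmem.1]
  · have ha : a < 0 := by
      by_contra! ha
      nlinarith [mul_nonneg ha hQ]
    have haR : (a : ℝ) < 0 := by exact_mod_cast ha
    have hcR : (1 : ℝ) ≤ c := by exact_mod_cast hc
    nlinarith [hmem.2]

/-- A point of a subcone that is a sum of at least two generators is not a best approximation. -/
theorem exists_better_of_two_le (hω : 1 < ω) (hirr : Irrational ω)
    (hP0 : P 0 = 0) (hP1 : P 1 = 1) (hQ0 : Q 0 = 1) (hQ1 : Q 1 = 0)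
    (hPrec : ∀ k : ℕ, P (k + 2) = cfrac ω k * P (k + 1) + P k)
    (hQrec : ∀ k : ℕ, Q (k + 2) = cfrac ω k * Q (k + 1) + Q k) {p q : ℤ} (hq : 1 ≤ q)
    (happrox : |(q : ℝ) * ω - (p : ℝ)| < 1) {k : ℕ} {c a : ℤ} (hc : 2 ≤ c) (ha : 0 ≤ a)
    (hac : a < c * cfrac ω k) (hp : p = c * P k + a * P (k + 1))
    (hqc : q = c * Q k + a * Q (k + 1)) :
    ∃ p' q' : ℤ, 0 < q' ∧ q' < q ∧
      ((q' : ℝ) * ω - (p' : ℝ)) ∈ Set.uIcc (0 : ℝ) ((q : ℝ) * ω - (p : ℝ)) := by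
  obtain ⟨hpos, hneg, -⟩ := convergent_error hω hirr hP0 hP1 hQ0 hQ1 hPrec hQrec k
  have hnext := (convergent_error hω hirr hP0 hP1 hQ0 hQ1 hPrec hQrec (k + 2)).1
  have hsR : (-1 : ℝ) ^ k = 1 ∨ (-1 : ℝ) ^ k = -1 := neg_one_pow_eq_or ℝ k
  obtain ⟨l, hl0, hla, hlc, hlb⟩ : ∃ l : ℤ, 0 ≤ l ∧ a ≤ c * l ∧ c * l ≤ a + c - 1 ∧
      l ≤ cfrac ω k := by
    have h₁ := Int.mul_ediv_add_emod (a + c - 1) c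
    have h₂ := Int.emod_nonneg (a + c - 1) (show c ≠ 0 by omega)
    have h₃ := Int.emod_lt_of_pos (a + c - 1) (show 0 < c by omega)
    refine ⟨(a + c - 1) / c, Int.ediv_nonneg (by omega) (by omega), by linarith, by linarith, ?_⟩
    by_contra! h
    nlinarith
  have hD : (-1 : ℝ) ^ k * (q * ω - p) = c * ((-1 : ℝ) ^ k * (Q k * ω - P k)) +
      a * ((-1 : ℝ) ^ k * (Q (k + 1) * ω - P (k + 1))) := by
    rw [hp, hqc]; push_cast; ring
  have hD' : (-1 : ℝ) ^ k * (((Q k + l * Q (k + 1) : ℤ) : ℝ) * ω - (P k + l * P (k + 1) : ℤ)) =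
      (-1 : ℝ) ^ k * (Q k * ω - P k) + l * ((-1 : ℝ) ^ k * (Q (k + 1) * ω - P (k + 1))) := by
    push_cast; ring
  have hD'pos : 0 < (-1 : ℝ) ^ k * (Q k * ω - P k) +
      l * ((-1 : ℝ) ^ k * (Q (k + 1) * ω - P (k + 1))) := by
    have hlR : (l : ℝ) ≤ cfrac ω k := by exact_mod_cast hlb
    rw [hPrec, hQrec, pow_add] at hnext
    push_cast at hnext
    nlinarith
  have hcR : (2 : ℝ) ≤ c := by exact_mod_cast hc
  have hlaR : (a : ℝ) ≤ c * l := by exact_mod_cast hla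
  have hle : (-1 : ℝ) ^ k * (Q k * ω - P k) +
      l * ((-1 : ℝ) ^ k * (Q (k + 1) * ω - P (k + 1))) ≤ (-1 : ℝ) ^ k * (q * ω - p) := by
    rw [hD]
    nlinarith [mul_nonneg (sub_nonneg.2 hlaR) (neg_nonneg.2 hneg.le)]
  have hlea : l ≤ a := by
    rcases ha.eq_or_lt with h | h <;> nlinarith
  refine ⟨P k + l * P (k + 1), Q k + l * Q (k + 1), ?_⟩
  rw [Set.mem_uIcc_zero_iff_of_sign hsR (hD'pos.trans_le hle), hD', ← and_assoc]
  refine ⟨?_, hD'pos.le, hle⟩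
  have hQk1 := convergent_den_nonneg hω hirr hQ0 hQ1 hQrec (k + 1)
  by_cases hk : k = 1
  · subst hk
    have hQ2 : Q 2 = 1 := by rw [hQrec 0, hQ0]; simp [hQ1]
    have hP2 : P 2 = ⌊ω⌋ := by rw [hPrec 0, hP0]; simp [hP1, cfrac, cfracAux]
    simp only [hQ1, hP1, Nat.reduceAdd, hQ2, hP2] at hp hqc ⊢
    have ha2 : 2 ≤ a := by
      by_contra! h
      obtain rfl : a = 1 := by omega
      obtain rfl : q = 1 := by omega
      rw [abs_lt] at happrox
      have hfl := Int.lt_floor_add_one ω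
      rw [hp] at happrox
      push_cast at happrox
      linarith [happrox.1]
    constructor <;> nlinarith
  · have hQk : 1 ≤ Q k := by
      match k, hk with
      | 0, _ => exact hQ0.ge
      | k + 2, _ => exact one_le_convergent_den hω hirr hQ0 hQ1 hQrec k
    constructor <;> nlinarith [mul_nonneg hl0 hQk1, mul_nonneg (sub_nonneg.2 hlea) hQk1]

end Convergents

/-- Characterization of one-sided best approximations of the second type.
Here `P (k+2) = pₖ` and `Q (k+2) = qₖ` are the convergent numerators/denominators of
`ω` (so `P 0 = p₋₂ = 0`, `P 1 = p₋₁ = 1`, `Q 0 = q₋₂ = 1`, `Q 1 = q₋₁ = 0`). For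
integers `p` and `q ≥ 1` with `|qω − p| < 1`, the following are equivalent:
(i) no `(p', q')` with `0 < q' < q` has `q'ω − p'` in the closed interval with
endpoints `0` and `qω − p`;
(ii) `p = l pₖ + p_{k−1}` and `q = l qₖ + q_{k−1}` for some `k ≥ −1` and
`1 ≤ l ≤ b_{k+1}` (in the shifted indexing: `p = l * P (k+1) + P k`,
`q = l * Q (k+1) + Q k` with `1 ≤ l ≤ cfrac ω k`, `k : ℕ`). -/
theorem stmt_16
    (ω : ℝ) (hω : 1 < ω) (hirr : Irrational ω)
    (P Q : ℕ → ℤ)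
    (hP0 : P 0 = 0) (hP1 : P 1 = 1)
    (hQ0 : Q 0 = 1) (hQ1 : Q 1 = 0)
    (hPrec : ∀ k : ℕ, P (k + 2) = cfrac ω k * P (k + 1) + P k)
    (hQrec : ∀ k : ℕ, Q (k + 2) = cfrac ω k * Q (k + 1) + Q k)
    (p q : ℤ) (hq : 1 ≤ q) (happrox : |(q : ℝ) * ω - (p : ℝ)| < 1) :
    (¬ ∃ p' q' : ℤ, 0 < q' ∧ q' < q ∧
        ((q' : ℝ) * ω - (p' : ℝ)) ∈ Set.uIcc (0 : ℝ) ((q : ℝ) * ω - (p : ℝ))) ↔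
    (∃ (k : ℕ) (l : ℤ), 1 ≤ l ∧ l ≤ cfrac ω k ∧
        p = l * P (k + 1) + P k ∧ q = l * Q (k + 1) + Q k) := by
  refine ⟨fun h => ?_, fun ⟨k, l, _, hl, hp, hql⟩ =>
    semiconvergent_best hω hirr hP0 hP1 hQ0 hQ1 hPrec hQrec hq hl hp hql⟩
  have hp0 : 0 < p := by
    have hqR : (1 : ℝ) ≤ q := by exact_mod_cast hq
    have : (0 : ℝ) < p := by nlinarith [(abs_lt.1 happrox).2]
    exact_mod_cast this
  obtain ⟨k, c, a, hc, ha, hac, hp, hqc⟩ :=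
    exists_convergent_cone (p := p) (q := q) hω hirr hPrec hQrec (p + q).toNat 0 q p hq
      hp0.le (by omega)
      (by simp [hP0, hP1]) (by simp [hQ0, hQ1])
  obtain rfl | hc2 := hc.eq_or_lt
  · rcases ha.eq_or_lt with rfl | ha
    · match k with
      | 0 => simp [hP0] at hp; omega
      | 1 => simp [hQ1] at hqc; omega
      | k + 2 =>
        exact ⟨k, cfrac ω k, one_le_cfrac hω hirr k, le_rfl, by simp [hp, hPrec],
          by simp [hqc, hQrec]⟩
    · exact ⟨k, a, ha, by linarith, by linarith, by linarith⟩
  · exact absurd (exists_better_of_two_le hω hirr hP0 hP1 hQ0 hQ1 hPrec hQrec hq happrox hc2 ha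
      hac hp hqc) h
end
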